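/- arXiv:2604.23326 — 6 statements merged into one kernel-verified Lean document; each statement's English description precedes it below -/
import Mathlib

section
/- Let S be a nonempty compact Hausdorff topological semilattice, i.e. a nonempty compact Hausdorff space with a meet-semilattice structure whose meet operation is continuous. Then S has a minimum element: there exists z ∈ S with z ≤ x for every x ∈ S. -/
/-- A nonempty compact Hausdorff topological semilattice has a
minimum element. -/
theorem compact_semilattice_has_minimum
    {S : Type*} [SemilatticeInf S] [TopologicalSpace S]
    [Nonempty S] [CompactSpace S] [T2Space S]
    (hmeet : Continuous fun p : S × S => p.1 ⊓ p.2) :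
    ∃ z : S, ∀ x : S, z ≤ x := by
  have hclosed (x : S) : IsClosed (Set.Iic x) := by
    have hIic : Set.Iic x = {y | y ⊓ x = y} := by
      ext y
      simp
    rw [hIic]
    exact isClosed_eq (hmeet.comp (Continuous.prodMk_left x)) continuous_id
  have hdirected : Directed (· ⊇ ·) (Set.Iic : S → Set S) := fun x y =>
    ⟨x ⊓ y, Set.Iic_subset_Iic.2 inf_le_left, Set.Iic_subset_Iic.2 inf_le_right⟩
  obtain ⟨z, hz⟩ := IsCompact.nonempty_iInter_of_directed_nonempty_isCompact_isClosed
    (Set.Iic : S → Set S) hdirected (fun _ => Set.nonempty_Iic)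
    (fun x => (hclosed x).isCompact) hclosed
  exact ⟨z, fun x => Set.mem_iInter.1 hz x⟩
end

section
/- Let S be a topological Clifford semigroup. Then every maximal subgroup G_e (e ∈ E(S)) is open in S if and only if the set of idempotents E(S), with the subspace topology, is discrete. -/
/-- In a topological Clifford semigroup, every maximal subgroup
`G_e` is open iff the set of idempotents `E(S)` is discrete in the subspace
topology. -/
theorem maximal_subgroups_open_iff_idempotents_discrete
    {S : Type*} [Semigroup S] [TopologicalSpace S] [ContinuousMul S]
    (inv : S → S) (hinv_cont : Continuous inv)
    (h1 : ∀ x : S, x * inv x * x = x)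
    (h2 : ∀ x : S, inv x * x * inv x = inv x)
    (h3 : ∀ x : S, x * inv x = inv x * x)
    (h4 : ∀ e : S, e * e = e → ∀ y : S, e * y = y * e) :
    (∀ e : S, e * e = e → IsOpen {x : S | x * inv x = e}) ↔
      DiscreteTopology {x : S // x * x = x} := by
  have mul_inv_of_idem : ∀ x : S, x * x = x → x * inv x = x := fun x hx => by
    have h := h1 x
    rwa [mul_assoc, ← h3, ← mul_assoc, hx] at h
  have mul_inv_idem : ∀ x : S, (x * inv x) * (x * inv x) = x * inv x := fun x => by
    rw [← mul_assoc, h1]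
  constructor
  · intro h
    rw [discreteTopology_iff_isOpen_singleton]
    rintro ⟨e, he⟩
    convert (h e he).preimage continuous_subtype_val using 1
    ext ⟨x, hx⟩
    simp [mul_inv_of_idem x hx]
  · intro _ e he
    let f : S → {x : S // x * x = x} := fun x => ⟨x * inv x, mul_inv_idem x⟩
    have hf : Continuous f := (continuous_id.mul hinv_cont).subtype_mk _
    convert (isOpen_discrete {(⟨e, he⟩ : {x : S // x * x = x})}).preimage hf using 1
    ext x
    simp [f]
end

section
/- Let S be a topological Clifford semigroup in which every maximal subgroup G_e (e ∈ E(S)) is open in S. Then E(S) is a Gδ subset of S if and only if, for every e ∈ E(S), the singleton {e} is a Gδ subset of the subspace G_e. -/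
/-- The image of a Gδ set under an open embedding is a Gδ set. -/
theorem IsGδ.image_of_isOpenEmbedding {X Y : Type*} [TopologicalSpace X] [TopologicalSpace Y]
    {f : X → Y} (hf : Topology.IsOpenEmbedding f) {A : Set X} (hA : IsGδ A) :
    IsGδ (f '' A) := by
  obtain ⟨V, hV, rfl⟩ := isGδ_iff_eq_iInter_nat.1 hA
  rw [hf.injective.injOn.image_iInter_eq]
  exact .iInter_of_isOpen fun n => hf.isOpenMap _ (hV n)

/-- A union of Gδ sets separated by pairwise disjoint open sets is a Gδ set. -/
theorem IsGδ.iUnion_of_pairwise_disjoint {X ι : Type*} [TopologicalSpace X]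
    {U A : ι → Set X} (hU : ∀ i, IsOpen (U i)) (hd : Pairwise fun i j => Disjoint (U i) (U j))
    (hAU : ∀ i, A i ⊆ U i) (hA : ∀ i, IsGδ (A i)) : IsGδ (⋃ i, A i) := by
  choose V hV hAV using fun i => isGδ_iff_eq_iInter_nat.1 (hA i)
  have key : ⋃ i, A i = ⋂ n, ⋃ i, V i n ∩ U i := by
    ext x
    simp only [Set.mem_iUnion, Set.mem_iInter, Set.mem_inter_iff]
    constructor
    · rintro ⟨i, hi⟩ n
      refine ⟨i, ?_, hAU i hi⟩
      rw [hAV i] at hi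
      exact Set.mem_iInter.1 hi n
    · intro h
      obtain ⟨i, -, hi⟩ := h 0
      refine ⟨i, ?_⟩
      rw [hAV i, Set.mem_iInter]
      intro n
      obtain ⟨j, hjV, hj⟩ := h n
      obtain rfl : i = j := hd.eq (Set.not_disjoint_iff.2 ⟨x, hi, hj⟩)
      exact hjV
  rw [key]
  exact .iInter_of_isOpen fun n => isOpen_iUnion fun i => (hV i n).inter (hU i)


/-- In a topological Clifford semigroup whose maximal
subgroups are all open, `E(S)` is a Gδ subset of `S` iff for every idempotent
`e` the singleton `{e}` is a Gδ subset of the subspace `G_e`. -/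
theorem idempotents_isGδ_iff_singletons_isGδ
    {S : Type*} [Semigroup S] [TopologicalSpace S] [ContinuousMul S]
    (inv : S → S) (hinv_cont : Continuous inv)
    (h1 : ∀ x : S, x * inv x * x = x)
    (h2 : ∀ x : S, inv x * x * inv x = inv x)
    (h3 : ∀ x : S, x * inv x = inv x * x)
    (h4 : ∀ e : S, e * e = e → ∀ y : S, e * y = y * e)
    (hopen : ∀ e : S, e * e = e → IsOpen {x : S | x * inv x = e}) :
    IsGδ {x : S | x * x = x} ↔
      ∀ e : S, e * e = e →
        IsGδ {y : {x : S // x * inv x = e} | (y : S) = e} := by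
  have idem (x : S) (hx : x * x = x) : x * inv x = x := by
    calc x * inv x = x * x * inv x := by rw [hx]
      _ = x * inv x * x := by rw [mul_assoc x (inv x), ← h3, ← mul_assoc]
      _ = x := h1 x
  constructor
  · intro hE e he
    convert hE.preimage (continuous_subtype_val (p := fun x : S => x * inv x = e)) using 1
    ext ⟨y, hy⟩
    exact ⟨fun h : y = e => by subst h; exact he, fun h => (idem y h).symm.trans hy⟩
  · intro h
    have key : {x : S | x * x = x} = ⋃ e : {e : S // e * e = e}, {e.1} := by
      ext x
      simp
    rw [key]
    refine IsGδ.iUnion_of_pairwise_disjoint (U := fun e => {x : S | x * inv x = e.1})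
      (fun e => hopen e.1 e.2) ?_ ?_ ?_
    · intro e f hef
      exact Set.disjoint_left.2 fun x hx hx' => hef (Subtype.ext (hx.symm.trans hx'))
    · rintro ⟨e, he⟩ x rfl
      exact idem x he
    · rintro ⟨e, he⟩
      convert (h e he).image_of_isOpenEmbedding (hopen e he).isOpenEmbedding_subtypeVal using 1
      ext x
      constructor
      · rintro rfl
        exact ⟨⟨x, idem x he⟩, rfl, rfl⟩
      · rintro ⟨y, hy, rfl⟩
        exact hy
end

section
/- Let S be a topological Clifford semigroup in which every maximal subgroup G_e (e ∈ E(S)) is open in S (i.e. S is a strong semilattice of topological groups). Then S is metrizable if and only if S is Hausdorff and first countable. -/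
/-- A Hausdorff first countable topological group is metrizable. -/
theorem IsTopologicalGroup.metrizableSpace_of_firstCountable
    (G : Type*) [Group G] [TopologicalSpace G] [IsTopologicalGroup G]
    [T2Space G] [FirstCountableTopology G] : TopologicalSpace.MetrizableSpace G := by
  let := IsTopologicalGroup.rightUniformSpace G
  have : (uniformity G).IsCountablyGenerated := by
    rw [uniformity_eq_comap_nhds_one']
    infer_instance
  exact UniformSpace.metrizableSpace

/-- A topological sum of metrizable spaces is metrizable. -/
theorem TopologicalSpace.MetrizableSpace.sigma {ι : Type*} {X : ι → Type*}
    [∀ i, TopologicalSpace (X i)] [∀ i, TopologicalSpace.MetrizableSpace (X i)] :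
    TopologicalSpace.MetrizableSpace (Σ i, X i) := by
  let := fun i => TopologicalSpace.metrizableSpaceMetric (X i)
  let : MetricSpace (Σ i, X i) := Metric.Sigma.metricSpace
  infer_instance

/-- A space with a locally constant map whose fibers are metrizable is metrizable. -/
theorem TopologicalSpace.MetrizableSpace.of_isOpen_fiber {X ι : Type*} [TopologicalSpace X]
    (p : X → ι) (hp : ∀ i, IsOpen {x | p x = i})
    (hm : ∀ i, TopologicalSpace.MetrizableSpace {x // p x = i}) :
    TopologicalSpace.MetrizableSpace X := by
  have : TopologicalSpace.MetrizableSpace (Σ i, {x // p x = i}) :=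
    TopologicalSpace.MetrizableSpace.sigma (X := fun i => {x // p x = i})
  have hf : IsHomeomorph (Equiv.sigmaFiberEquiv p) :=
    ⟨continuous_sigma fun _ => continuous_subtype_val,
      isOpenMap_sigma.2 fun i => (hp i).isOpenMap_subtype_val, (Equiv.sigmaFiberEquiv p).bijective⟩
  exact (hf.homeomorph.symm).isEmbedding.metrizableSpace

section Clifford

variable {S : Type*} [Semigroup S] {inv : S → S}

theorem clifford_mul_inv_idempotent (h1 : ∀ x : S, x * inv x * x = x) (x : S) :
    x * inv x * (x * inv x) = x * inv x := by
  rw [← mul_assoc, h1]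

/-- An element having `e` as a left identity and a right inverse relative to `e` lies in the
maximal subgroup at `e`. -/
theorem clifford_mul_inv_eq (h1 : ∀ x : S, x * inv x * x = x)
    (h4 : ∀ e : S, e * e = e → ∀ y : S, e * y = y * e)
    {e z w : S} (hez : e * z = z) (hzw : z * w = e) : z * inv z = e := by
  have hfe : z * inv z * e = e := by rw [← hzw, ← mul_assoc, h1]
  rw [← hfe, h4 _ (clifford_mul_inv_idempotent h1 z), ← mul_assoc, hez]

/-- The maximal subgroup of a Clifford semigroup at an idempotent. -/
abbrev cliffordMaximalSubgroup (inv : S → S)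
    (h1 : ∀ x : S, x * inv x * x = x)
    (h2 : ∀ x : S, inv x * x * inv x = inv x)
    (h3 : ∀ x : S, x * inv x = inv x * x)
    (h4 : ∀ e : S, e * e = e → ∀ y : S, e * y = y * e)
    (e : S) (he : e * e = e) : Group {x : S // x * inv x = e} :=
  have left_id : ∀ x : S, x * inv x = e → e * x = x := by
    rintro x rfl
    exact h1 x
  letI : Mul {x : S // x * inv x = e} := ⟨fun x y => ⟨x.1 * y.1, by
    refine clifford_mul_inv_eq h1 h4 (w := inv y.1 * inv x.1) ?_ ?_
    · rw [← mul_assoc, left_id _ x.2]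
    · rw [mul_assoc, ← mul_assoc y.1, y.2, ← mul_assoc, ← h4 e he, left_id _ x.2, x.2]⟩⟩
  letI : One {x : S // x * inv x = e} := ⟨⟨e, clifford_mul_inv_eq h1 h4 he he⟩⟩
  letI : Inv {x : S // x * inv x = e} := ⟨fun x => ⟨inv x.1, by
    refine clifford_mul_inv_eq h1 h4 (w := x.1) ?_ ?_
    · exact (congrArg (· * inv x.1) (x.2.symm.trans (h3 x.1))).trans (h2 x.1)
    · rw [← h3, x.2]⟩⟩
  Group.ofLeftAxioms (fun x y z => Subtype.ext (mul_assoc x.1 y.1 z.1))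
    (fun x => Subtype.ext (left_id x.1 x.2))
    (fun x => Subtype.ext ((h3 x.1).symm.trans x.2))

end Clifford

/-- A topological Clifford semigroup whose maximal subgroups
are all open (i.e. a strong semilattice of topological groups) is metrizable
iff it is Hausdorff and first countable. -/
theorem strong_semilattice_metrizable_iff
    {S : Type*} [Semigroup S] [TopologicalSpace S] [ContinuousMul S]
    (inv : S → S) (hinv_cont : Continuous inv)
    (h1 : ∀ x : S, x * inv x * x = x)
    (h2 : ∀ x : S, inv x * x * inv x = inv x)
    (h3 : ∀ x : S, x * inv x = inv x * x)
    (h4 : ∀ e : S, e * e = e → ∀ y : S, e * y = y * e)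
    (hopen : ∀ e : S, e * e = e → IsOpen {x : S | x * inv x = e}) :
    TopologicalSpace.MetrizableSpace S ↔
      (T2Space S ∧ FirstCountableTopology S) := by
  refine ⟨fun _ => ⟨inferInstance, inferInstance⟩, fun ⟨_, _⟩ => ?_⟩
  have fiber_empty : ∀ e : S, ¬ e * e = e → {x : S | x * inv x = e} = ∅ := by
    rintro e he
    refine Set.eq_empty_of_forall_notMem ?_
    rintro x rfl
    exact he (clifford_mul_inv_idempotent h1 x)
  refine TopologicalSpace.MetrizableSpace.of_isOpen_fiber (fun x => x * inv x)
    (fun e => ?_) (fun e => ?_)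
  · by_cases he : e * e = e
    · exact hopen e he
    · rw [fiber_empty e he]
      exact isOpen_empty
  · by_cases he : e * e = e
    · let := cliffordMaximalSubgroup inv h1 h2 h3 h4 e he
      have : IsTopologicalGroup {x : S // x * inv x = e} :=
        { continuous_mul := ((continuous_subtype_val.comp continuous_fst).mul
            (continuous_subtype_val.comp continuous_snd)).subtype_mk _
          continuous_inv := (hinv_cont.comp continuous_subtype_val).subtype_mk _ }
      have : FirstCountableTopology {x : S // x * inv x = e} :=
        Topology.IsInducing.subtypeVal.firstCountableTopology
      exact IsTopologicalGroup.metrizableSpace_of_firstCountable _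
    · have : IsEmpty {x : S // x * inv x = e} := Set.isEmpty_coe_sort.2 (fiber_empty e he)
      infer_instance
end

section
/- Let S be a Clifford semigroup, write π(x) := x * inv x, and order E(S) by e ≤ f ⇔ e * f = e. Suppose ρ : S → S → ℝ restricts to a metric on E(S) (nonnegative, symmetric, zero exactly on the diagonal, triangle inequality, all for idempotent arguments), and suppose dG : S → S → ℝ restricts to a metric on each maximal subgroup G_e and satisfies the isometry condition: for all idempotents e, f with f * e = f and all s, t ∈ G_e, dG(f * s, f * t) = dG(s, t). Define d : S × S → ℝ by d(x, y) := ρ(π(x), π(y)) + dG(π(y) * x, π(x) * y) (note that π(y) * x and π(x) * y both lie in G_{π(x)π(y)}). Then d is a metric on S: it is nonnegative, symmetric, vanishes exactly when x = y, and satisfies the triangle inequality. -/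
/-- In a semigroup with central idempotents and inner inverses `inv`, left multiplication by an
idempotent commutes with `x ↦ x * inv x`. -/
theorem idempotent_mul_mul_inv {S : Type*} [Semigroup S] (inv : S → S)
    (h1 : ∀ x : S, x * inv x * x = x)
    (h4 : ∀ e : S, e * e = e → ∀ y : S, e * y = y * e)
    {e : S} (he : e * e = e) (x : S) :
    e * x * inv (e * x) = e * (x * inv x) := by
  have idem (x : S) : x * inv x * (x * inv x) = x * inv x := by
    rw [← mul_assoc, h1]
  have hqu : e * (x * inv x) * (e * x) = e * x := by
    rw [h4 e he x, mul_assoc e, ← mul_assoc (x * inv x), h1, h4 e he, mul_assoc, he]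
  have hqp : e * (x * inv x) * (e * x * inv (e * x)) = e * x * inv (e * x) := by
    rw [← mul_assoc, hqu]
  have hpq : e * x * inv (e * x) * (e * (x * inv x)) = e * (x * inv x) := by
    rw [← mul_assoc e x, ← mul_assoc, h1]
  rw [← hqp, ← h4 _ (idem (e * x)), hpq]

/-- On a Clifford semigroup with a metric `ρ` on the
idempotents and isometric bonding maps for a metric `dG` on the maximal
subgroups, `d (x, y) = ρ (π x) (π y) + dG (π y * x) (π x * y)` is a metric. -/
theorem yeager_isometric_metric
    {S : Type*} [Semigroup S] (inv : S → S)
    (h1 : ∀ x : S, x * inv x * x = x)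
    (h2 : ∀ x : S, inv x * x * inv x = inv x)
    (h3 : ∀ x : S, x * inv x = inv x * x)
    (h4 : ∀ e : S, e * e = e → ∀ y : S, e * y = y * e)
    (ρ : S → S → ℝ)
    -- `ρ` restricts to a metric on `E(S)`
    (hρnonneg : ∀ e f : S, e * e = e → f * f = f → 0 ≤ ρ e f)
    (hρsymm : ∀ e f : S, e * e = e → f * f = f → ρ e f = ρ f e)
    (hρeq : ∀ e f : S, e * e = e → f * f = f → (ρ e f = 0 ↔ e = f))
    (hρtri : ∀ e f g : S, e * e = e → f * f = f → g * g = g →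
      ρ e g ≤ ρ e f + ρ f g)
    (dG : S → S → ℝ)
    -- `dG` restricts to a metric on each maximal subgroup `G_e`
    (hGnonneg : ∀ e : S, e * e = e → ∀ x y : S,
      x * inv x = e → y * inv y = e → 0 ≤ dG x y)
    (hGsymm : ∀ e : S, e * e = e → ∀ x y : S,
      x * inv x = e → y * inv y = e → dG x y = dG y x)
    (hGeq : ∀ e : S, e * e = e → ∀ x y : S,
      x * inv x = e → y * inv y = e → (dG x y = 0 ↔ x = y))
    (hGtri : ∀ e : S, e * e = e → ∀ x y z : S,
      x * inv x = e → y * inv y = e → z * inv z = e →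
        dG x z ≤ dG x y + dG y z)
    -- the bonding maps are isometries
    (hiso : ∀ e f : S, e * e = e → f * f = f → f * e = f →
      ∀ s t : S, s * inv s = e → t * inv t = e → dG (f * s) (f * t) = dG s t) :
    -- `d (x, y) := ρ (π x) (π y) + dG (π y * x) (π x * y)` is a metric on `S`
    (∀ x y : S,
      0 ≤ ρ (x * inv x) (y * inv y) + dG ((y * inv y) * x) ((x * inv x) * y)) ∧
    (∀ x y : S,
      ρ (x * inv x) (y * inv y) + dG ((y * inv y) * x) ((x * inv x) * y) =
        ρ (y * inv y) (x * inv x) + dG ((x * inv x) * y) ((y * inv y) * x)) ∧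
    (∀ x y : S,
      (ρ (x * inv x) (y * inv y) + dG ((y * inv y) * x) ((x * inv x) * y) = 0
        ↔ x = y)) ∧
    (∀ x y z : S,
      ρ (x * inv x) (z * inv z) + dG ((z * inv z) * x) ((x * inv x) * z) ≤
        (ρ (x * inv x) (y * inv y) + dG ((y * inv y) * x) ((x * inv x) * y)) +
        (ρ (y * inv y) (z * inv z) + dG ((z * inv z) * y) ((y * inv y) * z))) := by
  have idem (x : S) : x * inv x * (x * inv x) = x * inv x := by
    rw [← mul_assoc, h1]
  have idem_mul {e f : S} (he : e * e = e) (hf : f * f = f) : e * f * (e * f) = e * f := by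
    rw [mul_assoc, ← mul_assoc f, h4 f hf e, mul_assoc, hf, ← mul_assoc, he]
  have proj {e : S} (he : e * e = e) (x : S) : e * x * inv (e * x) = e * (x * inv x) :=
    idempotent_mul_mul_inv inv h1 h4 he x
  have swap (x y : S) : x * inv x * y * inv (x * inv x * y) = y * inv y * (x * inv x) := by
    rw [proj (idem x), h4 _ (idem x)]
  have iso {h s t : S} (hh : h * h = h) (hst : t * inv t = s * inv s) :
      dG (h * s) (h * t) = dG s t := by
    have key := hiso (s * inv s) (h * (s * inv s)) (idem s) (idem_mul hh (idem s))
      (by rw [mul_assoc, idem]) s t rfl hst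
    have ht : h * (s * inv s) * t = h * t := by rw [← hst, mul_assoc, h1]
    rwa [mul_assoc, h1, ht] at key
  have nonneg (x y : S) : 0 ≤ dG (y * inv y * x) (x * inv x * y) :=
    hGnonneg _ (idem_mul (idem y) (idem x)) _ _ (proj (idem y) x) (swap x y)
  refine ⟨fun x y => ?_, fun x y => ?_, fun x y => ⟨fun h => ?_, ?_⟩, fun x y z => ?_⟩
  · exact add_nonneg (hρnonneg _ _ (idem x) (idem y)) (nonneg x y)
  · rw [hρsymm _ _ (idem x) (idem y),
      hGsymm _ (idem_mul (idem y) (idem x)) _ _ (proj (idem y) x) (swap x y)]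
  · have hρ := hρnonneg _ _ (idem x) (idem y)
    have hG := nonneg x y
    have hxy := (hρeq _ _ (idem x) (idem y)).1 (by linarith)
    have key := (hGeq _ (idem_mul (idem y) (idem x)) _ _ (proj (idem y) x) (swap x y)).1
      (by linarith)
    rwa [← hxy, h1, hxy, h1] at key
  · rintro rfl
    rw [(hρeq _ _ (idem x) (idem x)).2 rfl,
      (hGeq _ (idem_mul (idem x) (idem x)) _ _ (proj (idem x) x) (swap x x)).2 rfl, add_zero]
  · have hρ := hρtri _ _ _ (idem x) (idem y) (idem z)
    have hxy := iso (idem z) ((swap x y).trans (proj (idem y) x).symm)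
    have hyz := iso (idem x) ((swap y z).trans (proj (idem z) y).symm)
    have hxz := iso (idem y) ((swap x z).trans (proj (idem z) x).symm)
    have comm (x y w : S) : x * inv x * (y * inv y * w) = y * inv y * (x * inv x * w) := by
      rw [← mul_assoc, h4 _ (idem x), mul_assoc]
    rw [comm z y x, comm z x y] at hxy
    rw [comm x y z] at hyz
    have pcomm := h4 _ (idem x) (y * inv y)
    have tri := hGtri (y * inv y * (z * inv z * (x * inv x)))
      (idem_mul (idem y) (idem_mul (idem z) (idem x)))
      (y * inv y * (z * inv z * x)) (x * inv x * (z * inv z * y)) (y * inv y * (x * inv x * z))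
      (by rw [proj (idem y), proj (idem z)])
      (by rw [proj (idem x), proj (idem z), comm x z, pcomm, comm z y])
      (by rw [proj (idem y), proj (idem x), h4 _ (idem x)])
    linarith
end

section
/- Let S be a topological Clifford semigroup and let e ∈ E(S). Suppose there exist: a real Banach space X; open subsets U ⊆ W of S with e ∈ U ⊆ W; an open set V ⊆ X and a homeomorphism φ : W → V with φ(e) = 0; such that x * y ∈ W for all x, y ∈ U, and the coordinate multiplication map (u, v) ↦ φ(φ⁻¹(u) * φ⁻¹(v)) is continuously Fréchet differentiable (C¹) on φ(U) × φ(U). Then e is an isolated point of E(S): there exists an open set U' ⊆ S with e ∈ U' and E(S) ∩ U' = {e}. Consequently, if S is C¹ at every idempotent in this sense, then E(S) is discrete. -/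
open Filter Topology in
/-- If a local binary operation `m` on a normed space fixes `(0, 0)`, is differentiable there, and
translation by `0` is idempotent and the same from both sides, then `0` is an isolated solution of
`m (u, u) = u`. -/
theorem eventually_diag_ne_self_of_hasFDerivAt
    {X : Type*} [NormedAddCommGroup X] [NormedSpace ℝ X] {m : X × X → X} {D : X × X →L[ℝ] X}
    (hD : HasFDerivAt m D (0, 0)) (h0 : m (0, 0) = 0)
    (hidem : ∀ᶠ v in 𝓝 (0 : X), m (0, m (0, v)) = m (0, v))
    (hcomm : ∀ᶠ v in 𝓝 (0 : X), m (v, 0) = m (0, v)) :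
    ∀ᶠ u in 𝓝[≠] (0 : X), m (u, u) ≠ u := by
  have hr : HasFDerivAt (fun v : X => m (0, v)) (D.comp (.inr ℝ X X)) 0 :=
    HasFDerivAt.comp (0 : X) (f := fun v : X => ((0 : X), v)) hD (hasFDerivAt_prodMk_right 0 0)
  have hl : HasFDerivAt (fun v : X => m (v, 0)) (D.comp (.inl ℝ X X)) 0 :=
    HasFDerivAt.comp (0 : X) (f := fun v : X => (v, (0 : X))) hD (hasFDerivAt_prodMk_left 0 0)
  have hd : HasFDerivAt (fun v : X => m (v, v))
      (D.comp ((ContinuousLinearMap.id ℝ X).prod (.id ℝ X))) 0 :=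
    HasFDerivAt.comp (0 : X) (f := fun v : X => (v, v)) hD
      ((hasFDerivAt_id (0 : X)).prodMk (hasFDerivAt_id (0 : X)))
  set P : X →L[ℝ] X := D.comp (.inr ℝ X X) with hP
  have hPP : P.comp P = P := by
    have hr' : HasFDerivAt (fun v : X => m (0, v)) P (m (0, 0)) := by rwa [h0]
    have hrr : HasFDerivAt (fun v : X => m (0, m (0, v))) (P.comp P) 0 :=
      HasFDerivAt.comp (0 : X) (f := fun v : X => m (0, v)) hr' hr
    exact hrr.unique (hr.congr_of_eventuallyEq hidem)
  have hPl : D.comp (.inl ℝ X X) = P := hl.unique (hr.congr_of_eventuallyEq hcomm)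
  have hDz (z : X) : D (z, z) = P z + P z := by
    have h : D (z, z) = D (z, 0) + D (0, z) := by rw [← map_add]; simp
    have h' : D (z, 0) = P z := by simpa using DFunLike.congr_fun hPl z
    rw [h, h']; simp [hP]
  have hPz (z : X) : P (P z) = P z := DFunLike.congr_fun hPP z
  set T : X →L[ℝ] X :=
    D.comp ((ContinuousLinearMap.id ℝ X).prod (.id ℝ X)) - .id ℝ X with hT
  have hTz (z : X) : T z = P z + P z - z := by
    simp [hT, hDz]
  have hTT (z : X) : T (T z) = z := by
    simp only [hTz, map_sub, map_add, hPz]; abel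
  have hg : HasFDerivAt (fun v : X => m (v, v) - v) T 0 := hd.sub (hasFDerivAt_id (0 : X))
  have hne := hg.eventually_ne (c := 0)
    ⟨‖T‖₊, T.antilipschitz_of_bound fun z => by
      simpa only [hTT, coe_nnnorm] using T.le_opNorm (T z)⟩
  filter_upwards [hne] with u hu h
  exact hu (sub_eq_zero.mpr h)

/-- In a topological Clifford semigroup, if the multiplication
is `C¹` in a Banach chart around an idempotent `e`, then `e` is an isolated
point of `E(S)`. -/
theorem c1_at_idempotent_isolated
    {S : Type*} [Semigroup S] [TopologicalSpace S] [ContinuousMul S]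
    (inv : S → S) (hinv_cont : Continuous inv)
    (h1 : ∀ x : S, x * inv x * x = x)
    (h2 : ∀ x : S, inv x * x * inv x = inv x)
    (h3 : ∀ x : S, x * inv x = inv x * x)
    (h4 : ∀ e : S, e * e = e → ∀ y : S, e * y = y * e)
    (e : S) (he : e * e = e)
    -- a real Banach space `X`
    {X : Type*} [NormedAddCommGroup X] [NormedSpace ℝ X] [CompleteSpace X]
    -- open sets `e ∈ U ⊆ W ⊆ S` and an open set `V ⊆ X`
    (U W : Set S) (hU : IsOpen U) (hW : IsOpen W) (heU : e ∈ U) (hUW : U ⊆ W)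
    (V : Set X) (hV : IsOpen V)
    -- a homeomorphism `φ : W → V` with inverse `ψ` and `φ e = 0`
    (φ : S → X) (ψ : X → S)
    (hφW : ∀ x ∈ W, φ x ∈ V) (hψV : ∀ u ∈ V, ψ u ∈ W)
    (hψφ : ∀ x ∈ W, ψ (φ x) = x) (hφψ : ∀ u ∈ V, φ (ψ u) = u)
    (hφcont : ContinuousOn φ W) (hψcont : ContinuousOn ψ V)
    (hφe : φ e = 0)
    -- `U * U ⊆ W`
    (hmul : ∀ x ∈ U, ∀ y ∈ U, x * y ∈ W)
    -- the coordinate multiplication is `C¹` on `φ(U) × φ(U)`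
    (hC1 : ContDiffOn ℝ 1 (fun p : X × X => φ (ψ p.1 * ψ p.2))
      ((φ '' U) ×ˢ (φ '' U))) :
    ∃ U' : Set S, IsOpen U' ∧ e ∈ U' ∧ {x : S | x * x = x} ∩ U' = {e} := by
  have heW := hUW heU
  have h0V : (0 : X) ∈ V := hφe ▸ hφW e heW
  have hψ0 : ψ 0 = e := by rw [← hφe, hψφ e heW]
  have hVn : V ∈ nhds (0 : X) := hV.mem_nhds h0V
  have hψat : ContinuousAt ψ 0 := hψcont.continuousAt hVn
  have hUn : φ '' U ∈ nhds (0 : X) := by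
    filter_upwards [hVn, hψat.preimage_mem_nhds (hU.mem_nhds (hψ0.symm ▸ heU))] with v hv hvU
    exact ⟨ψ v, hvU, hφψ v hv⟩
  have hD := (((hC1.contDiffAt (x := (0, 0)) (prod_mem_nhds hUn hUn)).differentiableAt
    one_ne_zero)).hasFDerivAt
  have hne := eventually_diag_ne_self_of_hasFDerivAt hD (by simp [hψ0, he, hφe])
    (by
      filter_upwards [hUn] with v hv
      obtain ⟨x, hx, rfl⟩ := hv
      simp only [hψ0, hψφ x (hUW hx), hψφ _ (hmul e heU x hx), ← mul_assoc, he])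
    (by
      filter_upwards with v
      simp only [hψ0, h4 e he])
  replace hne : ∀ᶠ u in nhds (0 : X), u ≠ 0 → φ (ψ u * ψ u) ≠ u :=
    eventually_nhdsWithin_iff.mp hne
  have hφat : ContinuousAt φ e := hφcont.continuousAt (hW.mem_nhds heW)
  have hev : ∀ᶠ x in nhds e, x ∈ U ∧ (φ x ≠ 0 → φ (ψ (φ x) * ψ (φ x)) ≠ φ x) :=
    Filter.Eventually.and (hU.mem_nhds heU) (hφat.eventually (by rwa [hφe]))
  obtain ⟨U', hU', hU'o, heU'⟩ := eventually_nhds_iff.mp hev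
  refine ⟨U', hU'o, heU', Set.eq_singleton_iff_unique_mem.mpr ⟨⟨he, heU'⟩, ?_⟩⟩
  rintro x ⟨hx, hxU'⟩
  obtain ⟨hxU, hxne⟩ := hU' x hxU'
  have hxx : x * x = x := hx
  by_cases h : φ x = 0
  · rw [← hψφ x (hUW hxU), h, hψ0]
  · exact absurd (by rw [hψφ x (hUW hxU), hxx]) (hxne h)
end
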